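/- Let τ ∈ T^ℤ be a non-recurrent rule distribution template: there exist i ≤ j such that the pattern τ|_{[i,j]} appears only once in τ. Then there exists a finite set of local rules R and an assignment α : T → R such that the global rule H_{τ_α} of the NUCA defined by τ_α(x) = α(τ(x)) is pre-injective but not surjective. -/

import Mathlib

/-- A configuration `τ` over ℤ is non-recurrent if some finite pattern of `τ` occurs
exactly once: there are `i ≤ j` such that the only translate of `τ|_{[i,j]}` occurring
in `τ` is the trivial one. -/
def NonRecurrent {T : Type} (τ : ℤ → T) : Prop :=
  ∃ i j : ℤ, i ≤ j ∧ ∀ t : ℤ, (∀ x ∈ Finset.Icc i j, τ (x + t) = τ x) → t = 0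

/-- Pre-injectivity: any two distinct configurations that differ in only finitely
many cells have distinct images. -/
def PreInjective {G S : Type} (H : (G → S) → (G → S)) : Prop :=
  ∀ c e : G → S, {x : G | c x ≠ e x}.Finite → H c = H e → c = e

/-- States carry a claimed index inside an occurrence of the pattern, and a residue. -/
abbrev MarkedState (n : ℕ) : Type := Option (Fin n) × ZMod (n + 1)

/-- The block `[s, s + n)` of `u` is marked consecutively by `0, …, n - 1`. -/
def IsMarkedBlock {n : ℕ} (u : ℤ → MarkedState n) (s : ℤ) : Prop :=
  ∀ l : Fin n, (u (s + (l : ℕ))).1 = some l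

/-- Forward difference of the residues. -/
def resDiff {n : ℕ} (u : ℤ → MarkedState n) (x : ℤ) : ZMod (n + 1) :=
  (u (x + 1)).2 - (u x).2

open Classical in
/-- The rule at cell `x` carrying template `t`: marks are kept, and residues are replaced by their
forward difference, from which the cyclically preceding difference is subtracted when the
cell lies in a marked block and `t` is the template that the pattern `p` prescribes there. -/
noncomputable def markedRule {T : Type} {n : ℕ} (p : Fin n → T) (t : T)
    (u : ℤ → MarkedState n) (x : ℤ) : MarkedState n :=
  ((u x).1,
    match (u x).1 with
    | none => resDiff u x
    | some k =>
      if IsMarkedBlock u (x - (k : ℕ)) ∧ t = p k then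
        resDiff u x - resDiff u (if (k : ℕ) = 0 then x + n - 1 else x - 1)
      else resDiff u x)

theorem markedRule_congr {T : Type} {n : ℕ} (p : Fin n → T) (t : T)
    {u v : ℤ → MarkedState n} {x y : ℤ}
    (h : ∀ z : ℤ, -n ≤ z → z ≤ n → u (x + z) = v (y + z)) (hn : 0 < n) :
    markedRule p t u x = markedRule p t v y := by
  have h0 : u x = v y := by simpa using h 0 (by omega) (by omega)
  have hd : ∀ z : ℤ, -n ≤ z → z < n → resDiff u (x + z) = resDiff v (y + z) := by
    intro z h1 h2
    simp only [resDiff, add_assoc]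
    rw [h z h1 h2.le, h (z + 1) (by omega) (by omega)]
  have hd0 : resDiff u x = resDiff v y := by simpa using hd 0 (by omega) (by omega)
  have hb : ∀ k : Fin n, IsMarkedBlock u (x - (k : ℕ)) ↔ IsMarkedBlock v (y - (k : ℕ)) := by
    intro k
    refine forall_congr' fun l => ?_
    have := h (-(k : ℕ) + (l : ℕ)) (by omega) (by omega)
    rw [show x - ((k : ℕ) : ℤ) + (l : ℕ) = x + (-(k : ℕ) + (l : ℕ)) by ring, this,
      show y - ((k : ℕ) : ℤ) + (l : ℕ) = y + (-(k : ℕ) + (l : ℕ)) by ring]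
  have hp : ∀ k : Fin n, resDiff u (if (k : ℕ) = 0 then x + n - 1 else x - 1) =
      resDiff v (if (k : ℕ) = 0 then y + n - 1 else y - 1) := by
    intro k
    split_ifs
    · simpa only [add_sub_assoc] using hd (n - 1) (by omega) (by omega)
    · simpa only [← sub_eq_add_neg] using hd (-1) (by omega) (by omega)
  simp only [markedRule, h0, hd0, hp]
  congr 1
  split
  · rfl
  · rw [hb]

/-- In a cyclic chain where each term repeats its predecessor or vanishes, all terms agree, and they
vanish as soon as one term is not required to repeat its predecessor. -/
theorem cyclic_chain {A : Type*} [Zero A] {n : ℕ} (g : ℕ → A) (P : ℕ → Prop)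
    (h1 : ∀ l < n, P l → g l = g (if l = 0 then n - 1 else l - 1))
    (h2 : ∀ l < n, ¬ P l → g l = 0) :
    (∀ l < n, g l = g 0) ∧ ((∃ k < n, ¬ P k) → ∀ l < n, g l = 0) := by
  by_cases hP : ∃ k < n, ¬ P k
  · have step : ∀ k < n, g k = 0 → ∀ l, k ≤ l → l < n → g l = 0 := by
      intro k _ hk l hkl
      induction l, hkl using Nat.le_induction with
      | base => exact fun _ => hk
      | succ l _ ih =>
        intro hl
        by_cases hPl : P (l + 1)
        · simpa [ih (by omega)] using h1 _ hl hPl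
        · exact h2 _ hl hPl
    obtain ⟨k, hk, hPk⟩ := hP
    have hlast := step k hk (h2 k hk hPk) (n - 1) (by omega) (by omega)
    have hzero : g 0 = 0 := by
      by_cases hP0 : P 0
      · simpa [hlast] using h1 0 (by omega) hP0
      · exact h2 0 (by omega) hP0
    have hall : ∀ l < n, g l = 0 := fun l hl => step 0 (by omega) hzero l (by omega) hl
    exact ⟨fun l hl => (hall l hl).trans hzero.symm, fun _ => hall⟩
  · refine ⟨fun l => ?_, fun h => absurd h hP⟩
    push Not at hP
    induction l with
    | zero => exact fun _ => rfl
    | succ l ih =>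
      intro hl
      rw [← ih (by omega)]
      simpa using h1 _ hl (hP _ hl)

/-- A finitely supported integer-indexed sequence is zero if its forward difference is constant on a
block of length `n` and zero elsewhere, in residues modulo `n + 1`. -/
theorem eq_zero_of_forward_diff {n : ℕ} (e : ℤ → ZMod (n + 1)) (i : ℤ) (δ : ZMod (n + 1))
    (hfin : {x | e x ≠ 0}.Finite)
    (hin : ∀ l < n, e (i + l + 1) - e (i + l) = δ)
    (hout : ∀ x, x < i ∨ i + n ≤ x → e (x + 1) - e x = 0) : e = 0 := by
  have right : ∀ x, i + n ≤ x → e x = e (i + n) := by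
    intro x hx
    induction x, hx using Int.leInduction with
    | base => rfl
    | succ x hx ih => rw [← ih]; exact sub_eq_zero.mp (hout x (Or.inr hx))
  have left : ∀ x, x ≤ i → e x = e i := by
    intro x hx
    induction x, hx using Int.leInductionDown with
    | base => rfl
    | pred x hx ih =>
      rw [← ih]
      simpa using (sub_eq_zero.mp (hout (x - 1) (Or.inl (by omega)))).symm
  obtain ⟨B, hB⟩ := hfin.bddAbove
  obtain ⟨C, hC⟩ := hfin.bddBelow
  have hr0 : e (i + n) = 0 := by
    rw [← right (max (i + n) (B + 1)) (le_max_left _ _)]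
    by_contra h
    have := hB h
    omega
  have hl0 : e i = 0 := by
    rw [← left (min i (C - 1)) (min_le_left _ _)]
    by_contra h
    have := hC h
    omega
  have mid : ∀ l : ℕ, l ≤ n → e (i + l) = l * δ := by
    intro l
    induction l with
    | zero => simp [hl0]
    | succ l ih =>
      intro hl
      have := hin l (by omega)
      rw [ih (by omega)] at this
      push_cast
      rw [← add_assoc]
      linear_combination this
  have hcast : (n : ZMod (n + 1)) = -1 := by
    have := ZMod.natCast_self (n + 1)
    push_cast at this
    linear_combination this
  have hδ : δ = 0 := by
    have := mid n le_rfl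
    rw [hr0, hcast] at this
    linear_combination this
  funext x
  rcases le_total x i with hx | hx
  · simpa [hl0] using left x hx
  rcases le_total (i + n) x with hx' | hx'
  · simpa [hr0] using right x hx'
  · have := mid (x - i).toNat (by omega)
    rwa [Int.toNat_of_nonneg (by omega), hδ, mul_zero, add_sub_cancel] at this

/-- If the pattern of `τ` on `[i, i + n)` occurs only there, the marked rule is pre-injective. -/
theorem markedRule_preInjective {T : Type} (τ : ℤ → T) (i : ℤ) {n : ℕ}
    (huniq : ∀ s : ℤ, (∀ l : Fin n, τ (s + (l : ℕ)) = τ (i + (l : ℕ))) → s = i) :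
    PreInjective (fun (c : ℤ → MarkedState n) (x : ℤ) =>
      markedRule (fun l : Fin n => τ (i + (l : ℕ))) (τ x) c x) := by
  intro c c' hfin hH
  have hmark : ∀ x, (c' x).1 = (c x).1 := fun x => (congrArg Prod.fst (congrFun hH x)).symm
  have hblock : IsMarkedBlock c' = IsMarkedBlock c := by
    funext s
    simp only [IsMarkedBlock, hmark]
  have hres : ∀ x, _ := fun x => congrArg Prod.snd (congrFun hH x)
  simp only [markedRule, hmark] at hres
  rw [hblock] at hres
  set d : ℤ → ZMod (n + 1) := fun x => resDiff c x - resDiff c' x with hd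
  have hnone : ∀ x, (∀ k : Fin n, (c x).1 = some k → ¬ IsMarkedBlock c (x - (k : ℕ))) →
      d x = 0 := by
    intro x hx
    have := hres x
    rcases hk : (c x).1 with _ | k
    · simp only [hk] at this
      simp [hd, this]
    · simp only [hk, hx k hk, false_and, if_false] at this
      simp [hd, this]
  have hchain : ∀ s, IsMarkedBlock c s → (∀ l < n, d (s + l) = d s) ∧
      (s ≠ i → ∀ l < n, d (s + l) = 0) := by
    intro s hs
    have key := cyclic_chain (n := n) (fun l : ℕ => d (s + l))
      (fun l => τ (s + l) = τ (i + l)) ?_ ?_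
    · refine ⟨by simpa using key.1, fun hsi => key.2 ?_⟩
      by_contra! hcon
      exact hsi (huniq s fun l => hcon l l.2)
    · intro l hl hm
      have := hres (s + l)
      have hsl := hs ⟨l, hl⟩
      simp only at hsl
      simp only [hsl, add_sub_cancel_right, hs, hm, true_and, if_true] at this
      by_cases h0 : l = 0
      · subst h0
        simp only [if_true] at this ⊢
        rw [show s + ((n - 1 : ℕ) : ℤ) = s + ((0 : ℕ) : ℤ) + n - 1 by push_cast; omega]
        simp only [hd]
        linear_combination this
      · simp only [h0, if_false] at this ⊢
        rw [show s + ((l - 1 : ℕ) : ℤ) = s + (l : ℤ) - 1 by omega]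
        simp only [hd]
        linear_combination this
    · intro l hl hm
      have := hres (s + l)
      have hsl := hs ⟨l, hl⟩
      simp only at hsl
      simp only [hsl, hm, and_false, if_false] at this
      simp [hd, this]
  have hzero : ∀ x, (∀ k : Fin n, (c x).1 = some k → IsMarkedBlock c (x - (k : ℕ)) →
      x - (k : ℕ) ≠ i) → d x = 0 := by
    intro x hx
    by_cases h : ∀ k : Fin n, (c x).1 = some k → ¬ IsMarkedBlock c (x - (k : ℕ))
    · exact hnone x h
    · push Not at h
      obtain ⟨k, hk, hb⟩ := h
      simpa using (hchain _ hb).2 (hx k hk hb) k k.2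
  have hdiff : ∀ x, ((c (x + 1)).2 - (c' (x + 1)).2) - ((c x).2 - (c' x).2) = d x := fun x => by
    simp only [hd, resDiff]
    ring
  have hout : ∀ x, x < i ∨ i + n ≤ x → d x = 0 :=
    fun x hx => hzero x fun k _ _ hk => by have := k.2; omega
  have hin : ∃ δ, ∀ l < n, d (i + l) = δ := by
    by_cases hb : IsMarkedBlock c i
    · exact ⟨d i, (hchain i hb).1⟩
    · exact ⟨0, fun l _ => hzero _ fun k _ hbk hki => hb (hki ▸ hbk)⟩
  obtain ⟨δ, hδ⟩ := hin
  have he : (fun x => (c x).2 - (c' x).2) = 0 := by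
    refine eq_zero_of_forward_diff _ i δ (hfin.subset fun x hx hcx => hx ?_) ?_ ?_
    · simp [hcx]
    · exact fun l hl => (hdiff _).trans (hδ l hl)
    · exact fun x hx => (hdiff _).trans (hout x hx)
  funext x
  exact Prod.ext (hmark x).symm (sub_eq_zero.mp (congrFun he x))

/-- The marked rule misses a configuration that marks exactly the true occurrence `[i, i + n)`. -/
theorem markedRule_not_surjective {T : Type} (τ : ℤ → T) (i : ℤ) {n : ℕ} (hn : 0 < n) :
    ¬ Function.Surjective (fun (c : ℤ → MarkedState n) (x : ℤ) =>
      markedRule (fun l : Fin n => τ (i + (l : ℕ))) (τ x) c x) := by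
  intro hsurj
  obtain ⟨c, hc⟩ := hsurj fun x =>
    (if h : (x - i).toNat < n then some ⟨(x - i).toNat, h⟩ else none, if x = i then 1 else 0)
  have hmark : ∀ x, (c x).1 =
      if h : (x - i).toNat < n then some ⟨(x - i).toNat, h⟩ else none :=
    fun x => congrArg Prod.fst (congrFun hc x)
  have hb : IsMarkedBlock c i := fun l => by
    rw [hmark]
    simp
  have hres : ∀ l : Fin n, resDiff c (i + (l : ℕ)) -
      resDiff c (if (l : ℕ) = 0 then i + (l : ℕ) + n - 1 else i + (l : ℕ) - 1) =
      if i + ((l : ℕ) : ℤ) = i then 1 else 0 := by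
    intro l
    have := congrArg Prod.snd (congrFun hc (i + (l : ℕ)))
    simpa only [markedRule, hb l, add_sub_cancel_right, hb, true_and, if_true] using this
  have hconst : ∀ l < n, resDiff c (i + l) = resDiff c i := by
    intro l
    induction l with
    | zero => simp
    | succ l ih =>
      intro hl
      have h := hres ⟨l + 1, hl⟩
      rw [if_neg (by simp), if_neg (by simp; omega)] at h
      rw [← ih (by omega), sub_eq_zero.mp h]
      congr 1
      push_cast
      ring
  have h0 := hres ⟨0, hn⟩
  have hl := hconst (n - 1) (by omega)
  rw [show i + ((n - 1 : ℕ) : ℤ) = i + n - 1 by omega] at hl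
  simp only [Nat.cast_zero, add_zero, if_true, hl, sub_self] at h0
  have : Fact (1 < n + 1) := ⟨by omega⟩
  exact zero_ne_one h0

/-- for any non-recurrent rule distribution template `τ` over a finite
template set `T`, there is a finite state set `S`, a neighbourhood `N : Fin m → ℤ`, and
an assignment `α` of local rules to templates such that the global rule of the NUCA
with rule distribution `τ_α = α ∘ τ` is pre-injective but not surjective. -/
theorem stmt_15 {T : Type} [Fintype T] (τ : ℤ → T) (hτ : NonRecurrent τ) :
    ∃ (S : Type) (_ : Fintype S) (m : ℕ) (N : Fin m → ℤ)
      (α : T → ((Fin m → S) → S)),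
      PreInjective (fun (c : ℤ → S) (x : ℤ) => α (τ x) (fun i => c (x + N i))) ∧
      ¬ Function.Surjective
          (fun (c : ℤ → S) (x : ℤ) => α (τ x) (fun i => c (x + N i))) := by
  obtain ⟨i, j, hij, huniq⟩ := hτ
  obtain ⟨n, hn⟩ : ∃ n : ℕ, (n : ℤ) = j - i + 1 := ⟨(j - i + 1).toNat, by omega⟩
  have hpos : 0 < n := by omega
  have huniq' : ∀ s : ℤ, (∀ l : Fin n, τ (s + (l : ℕ)) = τ (i + (l : ℕ))) → s = i := by
    intro s hs
    refine sub_eq_zero.mp (huniq (s - i) fun x hx => ?_)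
    rw [Finset.mem_Icc] at hx
    have := hs ⟨(x - i).toNat, by omega⟩
    simp only [Int.toNat_of_nonneg (sub_nonneg.mpr hx.1)] at this
    rwa [show s + (x - i) = x + (s - i) by ring, add_sub_cancel] at this
  let p : Fin n → T := fun l => τ (i + (l : ℕ))
  let N : Fin (2 * n + 1) → ℤ := fun k => (k : ℕ) - n
  let α : T → (Fin (2 * n + 1) → MarkedState n) → MarkedState n := fun t v =>
    markedRule p t (fun z => v (Fin.ofNat (2 * n + 1) (z + n).toNat)) 0
  have hα : (fun (c : ℤ → MarkedState n) (x : ℤ) => α (τ x) (fun k => c (x + N k))) =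
      fun c x => markedRule p (τ x) c x := by
    funext c x
    refine markedRule_congr p (τ x) (fun z h1 h2 => ?_) hpos
    have : (z + n).toNat % (2 * n + 1) = (z + n).toNat := Nat.mod_eq_of_lt (by omega)
    simp only [N, Fin.ofNat, zero_add, this]
    congr 1
    omega
  refine ⟨MarkedState n, inferInstance, 2 * n + 1, N, α, ?_⟩
  rw [hα]
  exact ⟨markedRule_preInjective τ i huniq', markedRule_not_surjective τ i hpos⟩
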